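/- arXiv:1305.7262 — 4 statements merged into one kernel-verified Lean document; each statement's English description precedes it below -/
import Mathlib

section
/- Let m ≥ 2 and let χ_1, …, χ_m be nonzero linear functionals on ℝ^{m−1} in general position with χ_1 + ⋯ + χ_m = 0. Then: (a) for every function ε : {1,…,m} → {−1,+1} that is not constant, there exists t ∈ ℝ^{m−1} such that ε(i)·χ_i(t) > 0 for every i = 1,…,m; (b) there is no t ∈ ℝ^{m−1} with χ_i(t) > 0 for all i, and no t with χ_i(t) < 0 for all i. In particular, for every index i there exists t with χ_i(t) > 0 and χ_j(t) < 0 for all j ≠ i. -/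
/-- Finitely many linearly independent functionals take arbitrary prescribed values. -/
theorem LinearIndependent.surjective_pi_dual {ι K V : Type*} [Finite ι] [Field K]
    [AddCommGroup V] [Module K V] {f : ι → V →ₗ[K] K} (hf : LinearIndependent K f) :
    Function.Surjective (LinearMap.pi f) := by
  have hcoe : LinearIndependent K (fun i => (f i : V → K)) :=
    hf.map' (LinearMap.ltoFun K V K K) (LinearMap.ker_eq_bot.2 DFunLike.coe_injective)
  rw [← LinearMap.range_eq_top, ← top_le_iff, ← span_flip_eq_top_iff_linearIndependent.2 hcoe,
    Submodule.span_le]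
  rintro _ ⟨v, rfl⟩
  exact ⟨v, rfl⟩

/-- If `χ` sums to zero and omitting some index leaves an independent family, then `χ` takes any
prescribed values that sum to zero. -/
theorem exists_forall_apply_eq_of_sum_eq_zero {ι K V : Type*} [Fintype ι] [Field K]
    [AddCommGroup V] [Module K V] {χ : ι → V →ₗ[K] K} (i₀ : ι)
    (hχ : LinearIndependent K (fun j : {j : ι // j ≠ i₀} => χ j)) (hsum : ∑ i, χ i = 0)
    {c : ι → K} (hc : ∑ i, c i = 0) : ∃ t, ∀ i, χ i t = c i := by
  classical
  obtain ⟨t, ht⟩ := hχ.surjective_pi_dual (fun j => c j)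
  have hoff : ∀ j, j ≠ i₀ → χ j t = c j := fun j hj => congrFun ht ⟨j, hj⟩
  have hsum_t : ∑ i, χ i t = 0 := by
    simpa using congrArg (fun φ : V →ₗ[K] K => φ t) hsum
  refine ⟨t, fun i => ?_⟩
  by_cases hi : i = i₀
  · subst hi
    rw [← Finset.add_sum_erase _ _ (Finset.mem_univ i)] at hsum_t hc
    rw [Finset.sum_congr rfl fun j hj => hoff j (Finset.ne_of_mem_erase hj)] at hsum_t
    exact add_right_cancel (hsum_t.trans hc.symm)
  · exact hoff i hi

/-- For `m ≥ 2` and nonzero linear functionals `χ 1, …, χ m` on `ℝ^(m-1)`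
in general position (any `m-1` of them are linearly independent) summing to zero:
(a) every non-constant sign pattern is realized, (b) neither the all-positive nor the
all-negative sign pattern is realized; in particular for every `i` there is `t` with
`χ i t > 0` and `χ j t < 0` for all `j ≠ i`. -/
theorem stmt0 (m : ℕ) (hm : 2 ≤ m)
    (χ : Fin m → ((Fin (m - 1) → ℝ) →ₗ[ℝ] ℝ))
    (hne : ∀ i, χ i ≠ 0)
    (hgen : ∀ i : Fin m,
      LinearIndependent ℝ (fun j : {j : Fin m // j ≠ i} => χ (j : Fin m)))
    (hsum : ∑ i, χ i = 0) :
    (∀ ε : Fin m → ℝ, (∀ i, ε i = 1 ∨ ε i = -1) → (∃ i j, ε i ≠ ε j) →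
      ∃ t : Fin (m - 1) → ℝ, ∀ i, 0 < ε i * χ i t) ∧
    (¬ ∃ t : Fin (m - 1) → ℝ, ∀ i, 0 < χ i t) ∧
    (¬ ∃ t : Fin (m - 1) → ℝ, ∀ i, χ i t < 0) ∧
    (∀ i : Fin m, ∃ t : Fin (m - 1) → ℝ,
      0 < χ i t ∧ ∀ j, j ≠ i → χ j t < 0) := by
  have hsum_apply : ∀ t, ∑ i, χ i t = 0 := fun t => by
    simpa using congrArg (fun φ : (Fin (m - 1) → ℝ) →ₗ[ℝ] ℝ => φ t) hsum
  have huniv : (Finset.univ : Finset (Fin m)).Nonempty := ⟨⟨0, by omega⟩, Finset.mem_univ _⟩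
  have hsign : ∀ ε : Fin m → ℝ, (∀ i, ε i = 1 ∨ ε i = -1) → (∃ i j, ε i ≠ ε j) →
      ∃ t : Fin (m - 1) → ℝ, ∀ i, 0 < ε i * χ i t := by
    rintro ε hε ⟨a, b, hab⟩
    have hc : ∑ i, ∑ j, (ε i - ε j) = 0 := by
      simp only [Finset.sum_sub_distrib]
      rw [Finset.sum_comm, sub_self]
    obtain ⟨t, ht⟩ := exists_forall_apply_eq_of_sum_eq_zero a (hgen a) hsum hc
    refine ⟨t, fun i => ?_⟩
    rw [ht, Finset.mul_sum]
    obtain ⟨k, hk⟩ : ∃ k, ε i ≠ ε k := by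
      by_contra! h
      exact hab ((h a).symm.trans (h b))
    refine Finset.sum_pos' (fun j _ => ?_) ⟨k, Finset.mem_univ k, ?_⟩
    · rcases hε i with hi | hi <;> rcases hε j with hj | hj <;> norm_num [hi, hj]
    · rcases hε i with hi | hi <;> rcases hε k with hj | hj <;> simp_all
  refine ⟨hsign, ?_, ?_, fun i => ?_⟩
  · rintro ⟨t, ht⟩
    exact (Finset.sum_pos (fun i _ => ht i) huniv).ne' (hsum_apply t)
  · rintro ⟨t, ht⟩
    exact (Finset.sum_neg (fun i _ => ht i) huniv).ne (hsum_apply t)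
  · have : Nontrivial (Fin m) := Fin.nontrivial_iff_two_le.2 hm
    obtain ⟨k, hk⟩ := exists_ne i
    obtain ⟨t, ht⟩ := hsign (fun j => if j = i then 1 else -1)
      (fun j => by by_cases hj : j = i <;> simp [hj]) ⟨i, k, by norm_num [hk]⟩
    refine ⟨t, by simpa using ht i, fun j hj => by simpa [hj] using ht j⟩
end

section
/- Let m ≥ 3 and let χ_1, …, χ_m and χ'_1, …, χ'_m be two families of nonzero linear functionals on ℝ^{m−1}, each family being in general position and summing to zero (χ_1 + ⋯ + χ_m = 0 and χ'_1 + ⋯ + χ'_m = 0). Suppose the associated entropy functions coincide: Σ_{i=1}^m max(χ_i(t),0) = Σ_{i=1}^m max(χ'_i(t),0) for all t ∈ ℝ^{m−1}. Then there exist a permutation σ of {1,…,m} and a sign ε ∈ {−1,+1} such that χ'_{σ(i)} = ε·χ_i for every i. -/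
open Filter Topology

/-- The second difference of `|·|` at `a` in direction `b`, for small steps `s > 0`, is zero unless
`a` is the kink. -/
lemma eventually_abs_second_difference (a b : ℝ) :
    ∀ᶠ s in 𝓝[>] (0 : ℝ),
      |a + s * b| + |a - s * b| - 2 * |a| = s * (2 * if a = 0 then |b| else 0) := by
  by_cases ha : a = 0
  · filter_upwards [self_mem_nhdsWithin] with s hs
    have hs' : (0 : ℝ) < s := hs
    simp only [ha, zero_add, zero_sub, abs_neg, abs_mul, abs_of_pos hs', abs_zero, if_true]
    ring
  · have key : ∀ᶠ s in 𝓝 (0 : ℝ), |s * b| < |a| := by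
      have hc : Continuous fun s : ℝ => |s * b| := by fun_prop
      exact hc.continuousAt.eventually_lt_const (by simpa using ha)
    filter_upwards [key.filter_mono nhdsWithin_le_nhds] with s hs
    rw [if_neg ha]
    rcases lt_or_gt_of_ne ha with h | h
    · rw [abs_of_neg h] at hs ⊢
      obtain ⟨h1, h2⟩ := abs_lt.mp hs
      rw [abs_of_neg (by linarith), abs_of_neg (by linarith)]
      ring
    · rw [abs_of_pos h] at hs ⊢
      obtain ⟨h1, h2⟩ := abs_lt.mp hs
      rw [abs_of_pos (by linarith), abs_of_pos (by linarith)]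
      ring

variable {V ι κ : Type*} [AddCommGroup V] [Module ℝ V] [Fintype ι] [Fintype κ]

lemma eventually_sum_abs_second_difference (f : ι → V →ₗ[ℝ] ℝ) (t v : V) :
    ∀ᶠ s in 𝓝[>] (0 : ℝ),
      (∑ i, |f i (t + s • v)|) + (∑ i, |f i (t - s • v)|) - 2 * ∑ i, |f i t| =
        s * (2 * ∑ i, if f i t = 0 then |f i v| else 0) := by
  have h : ∀ᶠ s in 𝓝[>] (0 : ℝ), ∀ i, |f i t + s * f i v| + |f i t - s * f i v| - 2 * |f i t| =
      s * (2 * if f i t = 0 then |f i v| else 0) :=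
    eventually_all.2 fun i => eventually_abs_second_difference _ _
  filter_upwards [h] with s hs
  simp only [Finset.mul_sum, ← Finset.sum_add_distrib, ← Finset.sum_sub_distrib, map_add, map_sub,
    map_smul, smul_eq_mul, hs]

/-- If two families of functionals have the same sum of absolute values, then at each point `t` the
functionals vanishing at `t` have the same sum of absolute values. -/
lemma sum_abs_vanishing_eq {f : ι → V →ₗ[ℝ] ℝ} {g : κ → V →ₗ[ℝ] ℝ}
    (h : ∀ t, ∑ i, |f i t| = ∑ k, |g k t|) (t v : V) :
    (∑ i, if f i t = 0 then |f i v| else 0) = ∑ k, if g k t = 0 then |g k v| else 0 := by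
  obtain ⟨s, ⟨hf, hg⟩, hs⟩ := (((eventually_sum_abs_second_difference f t v).and
    (eventually_sum_abs_second_difference g t v)).and self_mem_nhdsWithin).exists
  have hs' : (0 : ℝ) < s := hs
  rw [h, h, h, hg] at hf
  have := mul_left_cancel₀ hs'.ne' hf
  linarith

/-- The kernel of `g` contains a point at which only the members of a finite family proportional to
`g` vanish. -/
lemma exists_forall_apply_eq_zero_iff_mem_span (g : V →ₗ[ℝ] ℝ) (f : ι → V →ₗ[ℝ] ℝ) :
    ∃ t : V, ∀ i, f i t = 0 ↔ f i ∈ Submodule.span ℝ {g} := by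
  obtain ⟨t, htg, ht⟩ := Module.Dual.exists_forall_mem_ne_zero_of_forall_exists (LinearMap.ker g)
    (fun i : {i // f i ∉ Submodule.span ℝ {g}} => f i) <| by
      rintro ⟨i, hi⟩
      by_contra! hker
      refine hi ?_
      have := mem_span_of_iInf_ker_le_ker (L := fun _ : Unit => g) (K := f i)
        ((iInf_le _ ()).trans fun x hx => hker x hx)
      simpa using this
  refine ⟨t, fun i => ⟨fun h0 => ?_, fun hi => ?_⟩⟩
  · by_contra hi
    exact ht ⟨i, hi⟩ h0
  · obtain ⟨c, hc⟩ := Submodule.mem_span_singleton.1 hi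
    simp [← hc, LinearMap.mem_ker.1 htg]

/-- If two families of nonzero, pairwise nonproportional functionals have the same sum of absolute
values, then each member of the first agrees up to sign with a member of the second. -/
lemma exists_eq_or_eq_neg_of_sum_abs_eq {f : ι → V →ₗ[ℝ] ℝ} {g : κ → V →ₗ[ℝ] ℝ}
    (hf0 : ∀ i, f i ≠ 0) (hg0 : ∀ k, g k ≠ 0)
    (hf : ∀ i j, f j ∈ Submodule.span ℝ {f i} → j = i)
    (hg : ∀ k l, g l ∈ Submodule.span ℝ {g k} → l = k)
    (h : ∀ t, ∑ i, |f i t| = ∑ k, |g k t|) (i : ι) :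
    ∃ k, g k = f i ∨ g k = -f i := by
  classical
  obtain ⟨t, ht⟩ := exists_forall_apply_eq_zero_iff_mem_span (f i) (Sum.elim f g)
  have htf : ∀ j, f j t = 0 ↔ j = i := fun j =>
    (ht (Sum.inl j)).trans ⟨hf i j, fun e => e ▸ Submodule.mem_span_singleton_self _⟩
  have htg : ∀ k, g k t = 0 ↔ g k ∈ Submodule.span ℝ {f i} := fun k => ht (Sum.inr k)
  have hfv : ∀ v, |f i v| = ∑ k, if g k t = 0 then |g k v| else 0 := fun v => by
    rw [← sum_abs_vanishing_eq h t v]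
    simp [htf]
  obtain ⟨v, hv⟩ : ∃ v, f i v ≠ 0 := by
    by_contra! hcon
    exact hf0 i (LinearMap.ext hcon)
  obtain ⟨k, hk⟩ : ∃ k, g k t = 0 := by
    by_contra! hcon
    have := hfv v
    simp [hcon, hv] at this
  obtain ⟨c, hc⟩ := Submodule.mem_span_singleton.1 ((htg k).1 hk)
  have hc0 : c ≠ 0 := by
    rintro rfl
    exact hg0 k (by simpa using hc.symm)
  have hgt : ∀ l, g l t = 0 ↔ l = k := by
    refine fun l => ⟨fun hl => hg k l ?_, fun e => e ▸ hk⟩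
    rw [← hc, Submodule.span_singleton_smul_eq hc0.isUnit]
    exact (htg l).1 hl
  have hv' := hfv v
  simp only [hgt, Finset.sum_ite_eq', Finset.mem_univ, if_true, ← hc, LinearMap.smul_apply,
    smul_eq_mul, abs_mul] at hv'
  have habs : |c| = 1 := (mul_right_cancel₀ (abs_ne_zero.2 hv) (by rw [one_mul]; exact hv')).symm
  refine ⟨k, ?_⟩
  rcases eq_or_eq_neg_of_abs_eq habs with rfl | rfl
  · exact Or.inl (by rw [← hc, one_smul])
  · exact Or.inr (by rw [← hc, neg_one_smul])

/-- If every family obtained by omitting one of at least three vectors is linearly independent, then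
the vectors are pairwise nonproportional. -/
lemma eq_of_mem_span_singleton_of_linearIndependent_ne {W : Type*} [AddCommGroup W] [Module ℝ W]
    (hι : 2 < Fintype.card ι) {f : ι → W}
    (hgen : ∀ i, LinearIndependent ℝ (fun j : {j : ι // j ≠ i} => f j)) (i j : ι)
    (hij : f j ∈ Submodule.span ℝ {f i}) : j = i := by
  classical
  by_contra hne
  obtain ⟨k, hk⟩ : ∃ k, k ∉ ({i, j} : Finset ι) := by
    by_contra! hcon
    have := Finset.card_le_card (fun k _ => hcon k : (Finset.univ : Finset ι) ⊆ {i, j})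
    have := Finset.card_le_two (a := i) (b := j)
    rw [Finset.card_univ] at *
    omega
  simp only [Finset.mem_insert, Finset.mem_singleton, not_or] at hk
  refine (hgen k).notMem_span_image (s := {⟨i, Ne.symm hk.1⟩}) (x := ⟨j, Ne.symm hk.2⟩) ?_ ?_
  · simpa using hne
  · simpa using hij

/-- A family that sums to zero and becomes linearly independent when `i₀` is omitted satisfies only
linear relations with constant coefficients. -/
lemma coeff_eq_of_sum_smul_eq_zero {W : Type*} [AddCommGroup W] [Module ℝ W] {f : ι → W} {i₀ : ι}
    (hgen : LinearIndependent ℝ (fun j : {j : ι // j ≠ i₀} => f j)) (hsum : ∑ i, f i = 0)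
    {c : ι → ℝ} (hc : ∑ i, c i • f i = 0) (i : ι) : c i = c i₀ := by
  classical
  by_cases hi : i = i₀
  · rw [hi]
  have hrel : ∑ j, (c j - c i₀) • f j = 0 := by
    simp only [sub_smul, Finset.sum_sub_distrib, hc, ← Finset.smul_sum, hsum, smul_zero, sub_zero]
  rw [Fintype.sum_eq_add_sum_subtype_ne _ i₀, sub_self, zero_smul, zero_add] at hrel
  exact sub_eq_zero.1 (Fintype.linearIndependent_iff.1 hgen (fun j => c j - c i₀) hrel ⟨i, hi⟩)

lemma two_mul_sum_max_zero {f : ι → V →ₗ[ℝ] ℝ} (hsum : ∑ i, f i = 0) (t : V) :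
    2 * ∑ i, max (f i t) 0 = ∑ i, |f i t| := by
  have h0 : ∑ i, f i t = 0 := by simpa using congrArg (fun g : V →ₗ[ℝ] ℝ => g t) hsum
  have h : ∀ x : ℝ, 2 * max x 0 = |x| + x := fun x => by
    rcases le_total x 0 with hx | hx
    · rw [max_eq_right hx, abs_of_nonpos hx]; ring
    · rw [max_eq_left hx, abs_of_nonneg hx]; ring
  simp only [Finset.mul_sum, h, Finset.sum_add_distrib, h0, add_zero]

/-- For `m ≥ 3`, two families of nonzero linear functionals on `ℝ^(m-1)`
in general position (any `m-1` of them linearly independent), each summing to zero,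
with the same entropy function `t ↦ ∑ i, max (χ i t) 0`, coincide up to a permutation
and a simultaneous sign `ε ∈ {−1, +1}`. -/
theorem stmt3 (m : ℕ) (hm : 3 ≤ m)
    (χ χ' : Fin m → ((Fin (m - 1) → ℝ) →ₗ[ℝ] ℝ))
    (hne : ∀ i, χ i ≠ 0) (hne' : ∀ i, χ' i ≠ 0)
    (hgen : ∀ i : Fin m,
      LinearIndependent ℝ (fun j : {j : Fin m // j ≠ i} => χ (j : Fin m)))
    (hgen' : ∀ i : Fin m,
      LinearIndependent ℝ (fun j : {j : Fin m // j ≠ i} => χ' (j : Fin m)))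
    (hsum : ∑ i, χ i = 0) (hsum' : ∑ i, χ' i = 0)
    (hent : ∀ t : Fin (m - 1) → ℝ, ∑ i, max (χ i t) 0 = ∑ i, max (χ' i t) 0) :
    ∃ (σ : Equiv.Perm (Fin m)) (ε : ℝ), (ε = 1 ∨ ε = -1) ∧
      ∀ i, χ' (σ i) = ε • χ i := by
  have hcard : 2 < Fintype.card (Fin m) := by rw [Fintype.card_fin]; omega
  have hprop := eq_of_mem_span_singleton_of_linearIndependent_ne hcard hgen
  have hprop' := eq_of_mem_span_singleton_of_linearIndependent_ne hcard hgen'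
  have habs : ∀ t, ∑ i, |χ i t| = ∑ i, |χ' i t| := fun t => by
    rw [← two_mul_sum_max_zero hsum, ← two_mul_sum_max_zero hsum', hent]
  have hsign : ∀ i, ∃ k, ∃ c : ℝ, (c = 1 ∨ c = -1) ∧ χ' k = c • χ i := fun i => by
    obtain ⟨k, hk | hk⟩ := exists_eq_or_eq_neg_of_sum_abs_eq hne hne' hprop hprop' habs i
    · exact ⟨k, 1, Or.inl rfl, by rw [hk, one_smul]⟩
    · exact ⟨k, -1, Or.inr rfl, by ext; simp [hk]⟩
  choose τ c hc hτ using hsign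
  have hc0 : ∀ i, c i ≠ 0 := fun i => by rcases hc i with h | h <;> norm_num [h]
  have hinj : Function.Injective τ := fun i j hij => by
    refine hprop j i (Submodule.mem_span_singleton.2 ⟨(c i)⁻¹ * c j, ?_⟩)
    rw [mul_smul, ← hτ j, ← hij, hτ i, inv_smul_smul₀ (hc0 i)]
  let σ : Equiv.Perm (Fin m) := Equiv.ofBijective τ (Finite.injective_iff_bijective.1 hinj)
  have hrel : ∑ i, c i • χ i = 0 := by
    rw [← hsum', ← Equiv.sum_comp σ χ']
    exact Finset.sum_congr rfl fun i _ => (hτ i).symm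
  let i₀ : Fin m := ⟨0, by omega⟩
  refine ⟨σ, c i₀, hc i₀, fun i => ?_⟩
  rw [← coeff_eq_of_sum_smul_eq_zero (hgen i₀) hsum hrel i]
  exact hτ i
end

section
/- Let G be a group and I a central element of G with I² = 1 such that every commutator g·h·g⁻¹·h⁻¹ (g, h ∈ G) lies in the set {1, I}. Suppose G is generated by a finite set {f_1, …, f_k} together with I. Then the center of G equals the intersection of the centralizers of f_1, …, f_k and has index at most 2^k in G; in particular G possesses an abelian subgroup of finite index at most 2^k. -/
/-- If all commutators lie in `{1, I}`, every centralizer of an element has index at most two. -/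
theorem Subgroup.index_centralizer_singleton_of_commutator_mem_pair {G : Type*} [Group G] {I : G}
    (hcomm : ∀ g h : G, g * h * g⁻¹ * h⁻¹ ∈ ({1, I} : Set G)) (x : G) :
    (Subgroup.centralizer {x}).index ≠ 0 ∧ (Subgroup.centralizer {x}).index ≤ 2 := by
  have hsub : commutatorSet G ⊆ {1, I} := by
    rintro _ ⟨g, h, rfl⟩
    exact hcomm g h
  have : Finite (commutatorSet G) := (Set.toFinite _).subset hsub
  have hinj := (Subgroup.quotientCentralizerEmbedding x).injective
  have : Finite (G ⧸ Subgroup.centralizer {x}) := Finite.of_injective _ hinj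
  refine ⟨Nat.card_pos.ne', ?_⟩
  calc (Subgroup.centralizer {x}).index
      ≤ Nat.card (commutatorSet G) := Nat.card_le_card_of_injective _ hinj
    _ ≤ ({1, I} : Set G).ncard := Set.ncard_le_ncard hsub
    _ ≤ 2 := (Set.ncard_insert_le _ _).trans (by rw [Set.ncard_singleton])

/-- If `I` is a central element of a group `G` with `I² = 1`, every
commutator lies in `{1, I}`, and `G` is generated by `f 1, …, f k` together with `I`,
then the center of `G` equals the intersection of the centralizers of the `f i` and
has (finite) index at most `2^k`; in particular `G` has an abelian subgroup of finite
index at most `2^k`. -/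
theorem stmt6 {G : Type*} [Group G] (I : G) (hI : I ∈ Subgroup.center G)
    (hI2 : I ^ 2 = 1)
    (hcomm : ∀ g h : G, g * h * g⁻¹ * h⁻¹ ∈ ({1, I} : Set G))
    (k : ℕ) (f : Fin k → G)
    (hgen : Subgroup.closure (Set.range f ∪ {I}) = ⊤) :
    Subgroup.center G = (⨅ i, Subgroup.centralizer {f i}) ∧
    (Subgroup.center G).index ≠ 0 ∧ (Subgroup.center G).index ≤ 2 ^ k ∧
    ∃ H : Subgroup G, (∀ a ∈ H, ∀ b ∈ H, a * b = b * a) ∧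
      H.index ≠ 0 ∧ H.index ≤ 2 ^ k := by
  have hcenter : Subgroup.center G = ⨅ i, Subgroup.centralizer {f i} := by
    refine le_antisymm (le_iInf fun i => Subgroup.center_le_centralizer _) fun g hg => ?_
    rw [← Subgroup.centralizer_univ, ← Subgroup.coe_top, ← hgen, Subgroup.centralizer_closure,
      Subgroup.mem_centralizer_iff]
    rintro _ (⟨i, rfl⟩ | rfl)
    · exact Subgroup.mem_centralizer_iff.mp (Subgroup.mem_iInf.mp hg i) _ rfl
    · exact (Subgroup.mem_center_iff.mp hI g).symm
  have hindex i := Subgroup.index_centralizer_singleton_of_commutator_mem_pair hcomm (f i)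
  have hne : (Subgroup.center G).index ≠ 0 :=
    hcenter ▸ Subgroup.index_iInf_ne_zero fun i => (hindex i).1
  have hle : (Subgroup.center G).index ≤ 2 ^ k := by
    rw [hcenter]
    calc _ ≤ ∏ i, (Subgroup.centralizer {f i}).index := Subgroup.index_iInf_le _
      _ ≤ ∏ _i : Fin k, 2 := Finset.prod_le_prod' fun i _ => (hindex i).2
      _ = 2 ^ k := by simp
  exact ⟨hcenter, hne, hle, Subgroup.center G,
    fun a _ b hb => Subgroup.mem_center_iff.mp hb a, hne, hle⟩
end

section
/- Let s ≥ 2 and let P : ℝ^s → ℝ^s be a C¹ map. Suppose that for every ordered pair of indices (j,k) with 1 ≤ j, k ≤ s and j ≠ k there exist sequences (A_i) and (B_i) of invertible diagonal real s×s matrices such that: (a) sup_{‖z‖≤1} ‖B_i(P(A_i⁻¹ z)) − z‖ → 0 and sup_{‖z‖≤1} ‖D(B_i ∘ P ∘ A_i⁻¹)(z) − Id‖ → 0 as i → ∞, where D denotes the total (Fréchet) derivative; (b) for every x ∈ ℝ^s one has ‖A_i x‖ ≤ 1 for all sufficiently large i; (c) |(B_i)_{kk}| / |(A_i)_{jj}|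 → ∞ as i → ∞. Then P is an affine map whose linear part is an invertible diagonal matrix: there exist nonzero constants c_1, …, c_s and b ∈ ℝ^s such that P(x)_k = c_k x_k + b_k for all x and all k. -/
open Filter Topology

/-- The continuous linear map of `ι → ℝ` given by the diagonal matrix with entries `d`. -/
noncomputable def diagCLM {ι : Type*} (d : ι → ℝ) : (ι → ℝ) →L[ℝ] (ι → ℝ) :=
  ContinuousLinearMap.pi fun l => d l • ContinuousLinearMap.proj (R := ℝ) (φ := fun _ : ι => ℝ) l

@[simp]
theorem diagCLM_apply {ι : Type*} (d x : ι → ℝ) (l : ι) : diagCLM d x l = d l * x l := by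
  simp [diagCLM]

/-- If the derivatives of the rescalings `diag (b i) ∘ P ∘ diag (a i)⁻¹` tend to the identity
uniformly on the unit ball and `diag (a i) x` is eventually in the unit ball, then the rescaled
partial derivatives of `P` at `x` tend to the entries of the identity matrix. -/
theorem tendsto_rescaled_partial_deriv {ι : Type*} [Fintype ι] [DecidableEq ι]
    {P : (ι → ℝ) → (ι → ℝ)} (hP : Differentiable ℝ P) {a b : ℕ → ι → ℝ} (ha : ∀ i l, a i l ≠ 0)
    (hD : ∀ ε > (0 : ℝ), ∃ N : ℕ, ∀ i ≥ N, ∀ z : ι → ℝ, ‖z‖ ≤ 1 →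
      ‖fderiv ℝ (fun w : ι → ℝ => (fun l => b i l * P (fun l' => (a i l')⁻¹ * w l') l)) z
        - ContinuousLinearMap.id ℝ (ι → ℝ)‖ ≤ ε)
    {x : ι → ℝ} (hx : ∃ N : ℕ, ∀ i ≥ N, ‖(fun l => a i l * x l : ι → ℝ)‖ ≤ 1) (j k : ι) :
    Tendsto (fun i => b i k * (a i j)⁻¹ * fderiv ℝ P x (Pi.single j 1) k) atTop
      (𝓝 ((Pi.single j 1 : ι → ℝ) k)) := by
  rw [Metric.tendsto_atTop]
  intro ε hε
  obtain ⟨N, hN⟩ := hD (ε / 2) (by positivity)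
  obtain ⟨M, hM⟩ := hx
  refine ⟨max N M, fun i hi => ?_⟩
  have hbound := hN i (le_trans (le_max_left _ _) hi) _ (hM i (le_trans (le_max_right _ _) hi))
  have hback : diagCLM (fun l => (a i l)⁻¹) (fun l => a i l * x l) = x := by
    ext l
    simp [ha i l]
  have hderiv : HasFDerivAt (fun w : ι → ℝ => (fun l => b i l * P (fun l' => (a i l')⁻¹ * w l') l))
      ((diagCLM (b i)).comp ((fderiv ℝ P x).comp (diagCLM fun l => (a i l)⁻¹)))
      (fun l => a i l * x l) := by
    have hPx : HasFDerivAt P (fderiv ℝ P x)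
        (diagCLM (fun l => (a i l)⁻¹) (fun l => a i l * x l)) := by
      rw [hback]
      exact (hP x).hasFDerivAt
    have hcomp := (diagCLM (b i)).hasFDerivAt.comp _
      (hPx.comp _ (diagCLM fun l => (a i l)⁻¹).hasFDerivAt)
    refine hcomp.congr_of_eventuallyEq (Eventually.of_forall fun w => ?_)
    ext l
    simp only [Function.comp_apply, diagCLM_apply]
    congr 3
  rw [hderiv.fderiv] at hbound
  have hsingle : diagCLM (fun l => (a i l)⁻¹) (Pi.single j 1) = (a i j)⁻¹ • Pi.single j 1 := by
    ext l
    by_cases hl : l = j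
    · subst hl
      simp
    · simp [hl]
  have hentry := (norm_le_pi_norm _ k).trans
    (ContinuousLinearMap.le_of_opNorm_le _ hbound (Pi.single j 1))
  simp only [sub_apply, ContinuousLinearMap.comp_apply, hsingle, map_smul,
    ContinuousLinearMap.id_apply, Pi.sub_apply, Pi.smul_apply, diagCLM_apply, smul_eq_mul,
    Pi.norm_single, norm_one, mul_one] at hentry
  rw [Real.dist_eq, mul_assoc, ← Real.norm_eq_abs]
  have hassoc : b i k * ((a i j)⁻¹ * fderiv ℝ P x (Pi.single j 1) k)
      = (a i j)⁻¹ * (b i k * fderiv ℝ P x (Pi.single j 1) k) := by ring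
  rw [hassoc]
  linarith

/-- A differentiable map whose derivative is everywhere the linear map `L` differs from `L` by a
constant. -/
theorem eq_add_of_fderiv_eq {E F : Type*} [NormedAddCommGroup E] [NormedSpace ℝ E]
    [NormedAddCommGroup F] [NormedSpace ℝ F] {P : E → F} (hP : Differentiable ℝ P) {L : E →L[ℝ] F}
    (hL : ∀ x, fderiv ℝ P x = L) (x : E) : P x = L x + P 0 := by
  have hconst := is_const_of_fderiv_eq_zero (𝕜 := ℝ) (f := fun y => P y - L y)
    (hP.sub L.differentiable) (fun y => by
      rw [fderiv_fun_sub (hP y) L.differentiableAt, hL, L.fderiv, sub_self]) x 0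
  rw [map_zero, sub_zero] at hconst
  rw [← hconst, add_sub_cancel]


/-- Renormalization rigidity. Let `P : ℝ^s → ℝ^s` be `C¹` (`s ≥ 2`).
Suppose for every pair of distinct indices `j ≠ k` there are sequences of invertible
diagonal matrices `A i = diag (a i)` and `B i = diag (b i)` such that
(a) `B i ∘ P ∘ (A i)⁻¹` converges to the identity in `C¹` on the unit ball,
(b) for every `x`, `‖A i x‖ ≤ 1` for all large `i`, and
(c) `|(B i)ₖₖ| / |(A i)ⱼⱼ| → ∞`.
Then `P` is affine with invertible diagonal linear part: `P x k = c k * x k + v k`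
with all `c k ≠ 0`. -/
theorem stmt11 (s : ℕ) (hs : 2 ≤ s) (P : (Fin s → ℝ) → (Fin s → ℝ))
    (hP : ContDiff ℝ 1 P)
    (h : ∀ j k : Fin s, j ≠ k →
      ∃ a b : ℕ → Fin s → ℝ,
        (∀ i l, a i l ≠ 0) ∧ (∀ i l, b i l ≠ 0) ∧
        (∀ ε > (0 : ℝ), ∃ N : ℕ, ∀ i ≥ N, ∀ z : Fin s → ℝ, ‖z‖ ≤ 1 →
          ‖(fun l => b i l * P (fun l' => (a i l')⁻¹ * z l') l) - z‖ ≤ ε ∧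
          ‖fderiv ℝ (fun w : Fin s → ℝ =>
              (fun l => b i l * P (fun l' => (a i l')⁻¹ * w l') l)) z
            - ContinuousLinearMap.id ℝ (Fin s → ℝ)‖ ≤ ε) ∧
        (∀ x : Fin s → ℝ, ∃ N : ℕ, ∀ i ≥ N,
          ‖(fun l => a i l * x l : Fin s → ℝ)‖ ≤ 1) ∧
        Filter.Tendsto (fun i => |b i k| / |a i j|) Filter.atTop Filter.atTop) :
    ∃ c v : Fin s → ℝ, (∀ k, c k ≠ 0) ∧
      ∀ (x : Fin s → ℝ) (k : Fin s), P x k = c k * x k + v k := by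
  have hdiff : Differentiable ℝ P := hP.differentiable one_ne_zero
  have : Nontrivial (Fin s) := Fin.nontrivial_iff_two_le.mpr hs
  have hoff : ∀ (x : Fin s → ℝ) (j k : Fin s), j ≠ k → fderiv ℝ P x (Pi.single j 1) k = 0 := by
    intro x j k hjk
    obtain ⟨a, b, ha, hb, hD, hx, hratio⟩ := h j k hjk
    have hlim := (tendsto_rescaled_partial_deriv hdiff ha
      (fun ε hε => (hD ε hε).imp fun N hN i hi z hz => (hN i hi z hz).2) (hx x) j k).abs
    rw [Pi.single_eq_of_ne hjk.symm, abs_zero] at hlim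
    have hquot := hlim.mul hratio.inv_tendsto_atTop
    rw [mul_zero] at hquot
    have habs : Tendsto (fun _ : ℕ => |fderiv ℝ P x (Pi.single j 1) k|) atTop (𝓝 0) := by
      refine hquot.congr fun i => ?_
      have ha' := abs_ne_zero.mpr (ha i j)
      have hb' := abs_ne_zero.mpr (hb i k)
      simp only [Pi.inv_apply, abs_mul, abs_inv]
      field_simp
    exact abs_eq_zero.mp (tendsto_nhds_unique tendsto_const_nhds habs)
  have hdiag : ∀ k : Fin s, ∃ c : ℝ, c ≠ 0 ∧ ∀ x, fderiv ℝ P x (Pi.single k 1) k = c := by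
    intro k
    obtain ⟨j, hjk⟩ := exists_ne k
    obtain ⟨a, b, ha, hb, hD, hx, -⟩ := h j k hjk
    have hlim (x : Fin s → ℝ) :
        Tendsto (fun i => b i k * (a i k)⁻¹ * fderiv ℝ P x (Pi.single k 1) k) atTop (𝓝 1) := by
      simpa using tendsto_rescaled_partial_deriv hdiff ha
        (fun ε hε => (hD ε hε).imp fun N hN i hi z hz => (hN i hi z hz).2) (hx x) k k
    have hne : fderiv ℝ P 0 (Pi.single k 1) k ≠ 0 := by
      intro h0
      have h01 := hlim 0
      simp only [h0, mul_zero] at h01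
      exact zero_ne_one (tendsto_nhds_unique tendsto_const_nhds h01)
    refine ⟨_, hne, fun x => ?_⟩
    have hquot := (hlim x).div (hlim 0) one_ne_zero
    have hconst : Tendsto (fun _ : ℕ => fderiv ℝ P x (Pi.single k 1) k /
        fderiv ℝ P 0 (Pi.single k 1) k) atTop (𝓝 (1 / 1)) :=
      hquot.congr fun i =>
        mul_div_mul_left _ _ (mul_ne_zero (hb i k) (inv_ne_zero (ha i k)))
    have hone := tendsto_nhds_unique tendsto_const_nhds hconst
    rwa [div_one, div_eq_one_iff_eq hne] at hone
  choose c hc0 hc using hdiag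
  have hfderiv : ∀ x, fderiv ℝ P x = diagCLM c := by
    intro x
    refine ContinuousLinearMap.coe_injective (LinearMap.pi_ext' fun j => LinearMap.ext_ring ?_)
    ext k
    by_cases hjk : j = k
    · subst hjk
      simp [hc]
    · simp [hoff x j k hjk, Pi.single_eq_of_ne (Ne.symm hjk)]
  refine ⟨c, P 0, hc0, fun x k => ?_⟩
  rw [eq_add_of_fderiv_eq hdiff hfderiv x]
  simp
end
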